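/- Fix real parameters α > 0, β ∈ (0,1), η ≥ 0, δ ≥ 0 and k01, ..., k14 > 0. Then the set of eigenvalues of the generalised boundary-eigenvalue problem has no accumulation point in ℂ \ {−1/α}; that is, the only possible accumulation points of the eigenvalues in the extended complex plane are −1/α and infinity. -/

import Mathlib

/-- `ω₁ = e^{3πi/4}`. -/
noncomputable def ω1 : ℂ := Complex.exp (3 * Real.pi * Complex.I / 4)
/-- `ω₂ = e^{5πi/4}`. -/
noncomputable def ω2 : ℂ := Complex.exp (5 * Real.pi * Complex.I / 4)

/-- The sector `S = {ρ ∈ ℂ \ {0} : π/8 ≤ arg ρ ≤ π/4}`. -/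
def SectorS : Set ℂ := {ρ : ℂ | ρ ≠ 0 ∧ Real.pi / 8 ≤ ρ.arg ∧ ρ.arg ≤ Real.pi / 4}

/-- `λ ≠ −1/α` is an eigenvalue of the generalised boundary-eigenvalue problem if there is a
nonzero four times continuously differentiable `w : [0,1] → ℂ` with
`(1+αλ)w'''' + η w'' + 2λβ√η w' + (δλ + λ²)w = 0` on `[0,1]` and
`w''(0) = (k01 + λk02)w'(0)`, `w'''(0) = −(k03 + λk04)w(0)`,
`w''(1) = −(k11 + λk12)w'(1)`, `w'''(1) = (k13 + λk14)w(1)`. -/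
def IsEigenvalue (α β η δ k01 k02 k03 k04 k11 k12 k13 k14 : ℝ) (lam : ℂ) : Prop :=
  lam ≠ -(1 / α) ∧
  ∃ w : ℝ → ℂ, ContDiff ℝ 4 w ∧ (∃ s ∈ Set.Icc (0 : ℝ) 1, w s ≠ 0) ∧
    (∀ s ∈ Set.Icc (0 : ℝ) 1,
      (1 + α * lam) * iteratedDeriv 4 w s + η * iteratedDeriv 2 w s
        + 2 * lam * β * Real.sqrt η * deriv w s + (δ * lam + lam ^ 2) * w s = 0) ∧
    iteratedDeriv 2 w 0 = (k01 + lam * k02) * deriv w 0 ∧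
    iteratedDeriv 3 w 0 = -(k03 + lam * k04) * w 0 ∧
    iteratedDeriv 2 w 1 = -(k11 + lam * k12) * deriv w 1 ∧
    iteratedDeriv 3 w 1 = (k13 + lam * k14) * w 1

/-- The companion operator of the fourth-order linear equation whose leading derivative is `a`
times the function plus `b` times its first plus `c` times its second derivative. -/
noncomputable def companion (a b c : ℂ) : (Fin 4 → ℂ) →L[ℂ] (Fin 4 → ℂ) :=
  ContinuousLinearMap.pi
    ![.proj 1, .proj 2, .proj 3, a • .proj 0 + b • .proj 1 + c • .proj 2]

lemma companion_apply (a b c : ℂ) (y : Fin 4 → ℂ) :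
    companion a b c y = ![y 1, y 2, y 3, a * y 0 + b * y 1 + c * y 2] := by
  ext i
  fin_cases i <;> simp [companion]

lemma companion_eq (a b c : ℂ) :
    companion a b c = companion 0 0 0 + a • (companion 1 0 0 - companion 0 0 0)
      + b • (companion 0 1 0 - companion 0 0 0) + c • (companion 0 0 1 - companion 0 0 0) := by
  ext y i
  fin_cases i <;> simp [companion_apply]

lemma DifferentiableOn.companion {s : Set ℂ} {a b c : ℂ → ℂ} (ha : DifferentiableOn ℂ a s)
    (hb : DifferentiableOn ℂ b s) (hc : DifferentiableOn ℂ c s) :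
    DifferentiableOn ℂ (fun z => companion (a z) (b z) (c z)) s := by
  simp_rw [companion_eq (a _) (b _) (c _)]
  fun_prop

lemma DifferentiableOn.matrix_det {n : Type*} [Fintype n] [DecidableEq n] {s : Set ℂ}
    {M : ℂ → Matrix n n ℂ} (hM : ∀ i j, DifferentiableOn ℂ (fun z => M z i j) s) :
    DifferentiableOn ℂ (fun z => (M z).det) s := by
  simp_rw [Matrix.det_apply']
  refine DifferentiableOn.fun_sum fun σ _ => DifferentiableOn.const_mul ?_ _
  exact DifferentiableOn.fun_finsetProd fun i _ => hM _ _

lemma hasDerivAt_exp_smul_apply {E : Type*} [NormedAddCommGroup E] [NormedSpace ℂ E]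
    [CompleteSpace E] (A : E →L[ℂ] E) (x : E) (t : ℝ) :
    HasDerivAt (fun u : ℝ => NormedSpace.exp ((u : ℂ) • A) x) (A (NormedSpace.exp ((t : ℂ) • A) x)) t := by
  have h := hasDerivAt_exp_smul_const' (𝕂 := ℝ) A t
  have h2 := ((ContinuousLinearMap.apply ℂ E x).restrictScalars ℝ).hasFDerivAt.comp_hasDerivAt t h
  simpa [Function.comp_def] using h2

lemma exp_zero_smul_apply {E : Type*} [NormedAddCommGroup E] [NormedSpace ℂ E]
    (A : E →L[ℂ] E) (x : E) : NormedSpace.exp ((0 : ℂ) • A) x = x := by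
  simp

lemma eqOn_exp_smul_of_hasDerivAt {E : Type*} [NormedAddCommGroup E] [NormedSpace ℂ E]
    [CompleteSpace E] (A : E →L[ℂ] E) {y : ℝ → E}
    (hy : ∀ t ∈ Set.Icc (0 : ℝ) 1, HasDerivAt y (A (y t)) t) :
    Set.EqOn y (fun t => NormedSpace.exp ((t : ℂ) • A) (y 0)) (Set.Icc 0 1) := by
  refine ODE_solution_unique (v := fun _ => A) (K := ‖A‖₊) (fun _ => A.lipschitz)
    (fun t ht => (hy t ht).continuousAt.continuousWithinAt)
    (fun t ht => (hy t (Set.Ico_subset_Icc_self ht)).hasDerivWithinAt)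
    (fun t _ => (hasDerivAt_exp_smul_apply A (y 0) t).continuousAt.continuousWithinAt)
    (fun t _ => (hasDerivAt_exp_smul_apply A (y 0) t).hasDerivWithinAt) ?_
  simp

/-- The boundary form with coefficients `c`, evaluated on the Cauchy data `p.1` at `0` and
`p.2` at `1`. -/
noncomputable def boundaryForm (c : Fin 4 → ℂ) :
    (Fin 4 → ℂ) × (Fin 4 → ℂ) →ₗ[ℂ] (Fin 4 → ℂ) where
  toFun p := ![p.1 2 - c 0 * p.1 1, p.1 3 + c 1 * p.1 0, p.2 2 + c 2 * p.2 1, p.2 3 - c 3 * p.2 0]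
  map_add' p q := by
    ext i
    fin_cases i <;> simp <;> ring
  map_smul' r p := by
    ext i
    fin_cases i <;> simp <;> ring

/-- The matrix taking the Cauchy data at `0` of a solution of the linear system with
operator `A` to its boundary form. -/
noncomputable def boundaryMatrix (c : Fin 4 → ℂ) (A : (Fin 4 → ℂ) →L[ℂ] (Fin 4 → ℂ)) :
    Matrix (Fin 4) (Fin 4) ℂ :=
  LinearMap.toMatrix' (boundaryForm c ∘ₗ
    LinearMap.prod LinearMap.id (NormedSpace.exp A : (Fin 4 → ℂ) →L[ℂ] (Fin 4 → ℂ)).toLinearMap)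

lemma boundaryMatrix_mulVec (c : Fin 4 → ℂ) (A : (Fin 4 → ℂ) →L[ℂ] (Fin 4 → ℂ))
    (v : Fin 4 → ℂ) :
    (boundaryMatrix c A).mulVec v = boundaryForm c (v, NormedSpace.exp A v) := by
  simp [boundaryMatrix, LinearMap.toMatrix'_mulVec]

lemma differentiableOn_det_boundaryMatrix {s : Set ℂ} {c : ℂ → Fin 4 → ℂ}
    {A : ℂ → (Fin 4 → ℂ) →L[ℂ] (Fin 4 → ℂ)} (hc : DifferentiableOn ℂ c s)
    (hA : DifferentiableOn ℂ A s) :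
    DifferentiableOn ℂ (fun z => (boundaryMatrix (c z) (A z)).det) s := by
  have hexp : DifferentiableOn ℂ (fun z => NormedSpace.exp (A z)) s := fun z hz =>
    ((NormedSpace.exp_analytic (𝕂 := ℂ) (A z)).differentiableAt).comp_differentiableWithinAt z
      (hA z hz)
  have hc' : ∀ i, DifferentiableOn ℂ (fun z => c z i) s := fun i =>
    differentiableOn_pi.1 hc i
  refine DifferentiableOn.matrix_det fun i j => ?_
  have hent : ∀ k, DifferentiableOn ℂ (fun z => NormedSpace.exp (A z) (Pi.single j 1) k) s :=
    fun k => differentiableOn_pi.1 (hexp.clm_apply (differentiableOn_const _)) k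
  have h0 := hc' 0
  have h1 := hc' 1
  have h2 := hc' 2
  have h3 := hc' 3
  have e0 := hent 0
  have e1 := hent 1
  have e2 := hent 2
  have e3 := hent 3
  simp only [boundaryMatrix, LinearMap.toMatrix'_apply]
  fin_cases i <;> simp [boundaryForm] <;> fun_prop

/-- Energy estimate: real solutions of the damped equation with dissipative boundary conditions
have vanishing Cauchy data at `0`. -/
lemma cauchyData_eq_zero_of_dissipative {m η b κ K0 K1 K2 K3 : ℝ} (hη : 0 ≤ η)
    (hm : η / 2 ≤ m) (hm0 : 0 < m) (hκ : η / 2 ≤ κ) (hb : 0 ≤ b) (hK0 : 0 < K0)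
    (hK1 : b < m * K1) (hK2 : 0 ≤ K2) (hK3 : 0 ≤ K3)
    {y : Fin 4 → ℝ → ℝ} (h0 : ∀ t, HasDerivAt (y 0) (y 1 t) t)
    (h1 : ∀ t, HasDerivAt (y 1) (y 2 t) t) (h2 : ∀ t, HasDerivAt (y 2) (y 3 t) t)
    (h3 : ∀ t, HasDerivAt (y 3) (-(κ * y 0 t + 2 * b * y 1 t + η * y 2 t) / m) t)
    (hy0 : y 2 0 = K0 * y 1 0) (hy1 : y 3 0 = -(K1 * y 0 0)) (hy2 : y 2 1 = -(K2 * y 1 1))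
    (hy3 : y 3 1 = K3 * y 0 1) (i : Fin 4) : y i 0 = 0 := by
  let F : ℝ → ℝ := fun t => m * (y 3 t * y 0 t - y 2 t * y 1 t) + b * (y 0 t * y 0 t)
  have hF : ∀ t, HasDerivAt F (-(η * y 2 t * y 0 t + κ * y 0 t ^ 2 + m * y 2 t ^ 2)) t := by
    intro t
    have h := ((((h3 t).mul (h0 t)).sub ((h2 t).mul (h1 t))).const_mul m).add
      (((h0 t).mul (h0 t)).const_mul b)
    refine h.congr_deriv ?_
    linear_combination
      (-(κ * y 0 t + 2 * b * y 1 t + η * y 2 t)) * y 0 t * mul_inv_cancel₀ hm0.ne'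
  have hanti : Antitone F := by
    refine antitone_of_deriv_nonpos (fun t => (hF t).differentiableAt) fun t => ?_
    rw [(hF t).deriv]
    nlinarith [mul_nonneg hη (sq_nonneg (y 2 t + y 0 t)),
      mul_nonneg (sub_nonneg.2 hm) (sq_nonneg (y 2 t)),
      mul_nonneg (sub_nonneg.2 hκ) (sq_nonneg (y 0 t))]
  have hle : F 1 ≤ F 0 := hanti zero_le_one
  simp only [F, hy0, hy1, hy2, hy3] at hle
  have p1 : 0 ≤ m * (K3 * y 0 1 ^ 2 + K2 * y 1 1 ^ 2) + b * y 0 1 ^ 2 := by positivity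
  have p2 : (m * K1 - b) * y 0 0 ^ 2 + m * K0 * y 1 0 ^ 2 ≤ 0 := by nlinarith
  have p3 : 0 < m * K1 - b := sub_pos.2 hK1
  have p4 : 0 ≤ (m * K1 - b) * y 0 0 ^ 2 := by positivity
  have p5 : 0 ≤ m * K0 * y 1 0 ^ 2 := by positivity
  have z0 : y 0 0 = 0 := by
    have : (m * K1 - b) * y 0 0 ^ 2 = 0 := by linarith
    simpa [p3.ne'] using this
  have z1 : y 1 0 = 0 := by
    have : m * K0 * y 1 0 ^ 2 = 0 := by linarith
    simpa [hm0.ne', hK0.ne'] using this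
  fin_cases i <;> simp [z0, z1, hy0, hy1]

lemma det_boundaryMatrix_ne_zero {m η b κ K0 K1 K2 K3 : ℝ} (hη : 0 ≤ η)
    (hm : η / 2 ≤ m) (hm0 : 0 < m) (hκ : η / 2 ≤ κ) (hb : 0 ≤ b) (hK0 : 0 < K0)
    (hK1 : b < m * K1) (hK2 : 0 ≤ K2) (hK3 : 0 ≤ K3) :
    (boundaryMatrix ![(K0 : ℂ), K1, K2, K3]
      (companion (-κ / m) (-(2 * b) / m) (-η / m))).det ≠ 0 := by
  intro hdet
  obtain ⟨v, hv, hMv⟩ := Matrix.exists_mulVec_eq_zero_iff.2 hdet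
  rw [boundaryMatrix_mulVec] at hMv
  set A := companion (-κ / m) (-(2 * b) / m) (-η / m) with hA
  let y : ℝ → Fin 4 → ℂ := fun t => NormedSpace.exp ((t : ℂ) • A) v
  have hy : ∀ t, HasDerivAt y (A (y t)) t := hasDerivAt_exp_smul_apply A v
  have hyi : ∀ t i, HasDerivAt (fun t => y t i) (A (y t) i) t := fun t i =>
    hasDerivAt_pi.1 (hy t) i
  have hy0 : y 0 = v := by
    simp only [y, Complex.ofReal_zero]
    exact exp_zero_smul_apply A v
  have hy1 : y 1 = NormedSpace.exp A v := by simp [y]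
  rw [← hy1, ← hy0] at hMv
  have b0 := congrFun hMv 0
  have b1 := congrFun hMv 1
  have b2 := congrFun hMv 2
  have b3 := congrFun hMv 3
  simp only [boundaryForm, LinearMap.coe_mk, AddHom.coe_mk, Matrix.cons_val, Pi.zero_apply]
    at b0 b1 b2 b3
  have key : ∀ L : ℂ →L[ℝ] ℝ, ∀ i, L (v i) = 0 := by
    intro L i
    have hmul : ∀ (r : ℝ) (z : ℂ), L (r * z) = r * L z := fun r z => by
      rw [← Complex.real_smul, L.map_smul, smul_eq_mul]
    have hL : ∀ t i, HasDerivAt (fun t => L (y t i)) (L (A (y t) i)) t := fun t i =>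
      L.hasFDerivAt.comp_hasDerivAt t (hyi t i)
    have := cauchyData_eq_zero_of_dissipative hη hm hm0 hκ hb hK0 hK1 hK2 hK3
      (y := fun i t => L (y t i)) (fun t => ?_) (fun t => ?_) (fun t => ?_) (fun t => ?_)
      ?_ ?_ ?_ ?_ i
    · simpa [hy0] using this
    · simpa [hA, companion_apply] using hL t 0
    · simpa [hA, companion_apply] using hL t 1
    · simpa [hA, companion_apply] using hL t 2
    · convert hL t 3 using 1
      have e : A (y t) 3 = ((-κ / m : ℝ) : ℂ) * y t 0 + ((-(2 * b) / m : ℝ) : ℂ) * y t 1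
          + ((-η / m : ℝ) : ℂ) * y t 2 := by
        simp [hA, companion_apply]
      rw [e, map_add, map_add, hmul, hmul, hmul]
      ring
    · rw [← hmul, sub_eq_zero.1 b0]
    · rw [← hmul, ← map_neg, eq_neg_of_add_eq_zero_left b1]
    · rw [← hmul, ← map_neg, eq_neg_of_add_eq_zero_left b2]
    · rw [← hmul, sub_eq_zero.1 b3]
  exact hv (funext fun i => Complex.ext (key Complex.reCLM i) (key Complex.imCLM i))

lemma one_add_mul_ne_zero {α : ℝ} (hα : 0 < α) {lam : ℂ} (h : lam ≠ -(1 / α)) :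
    1 + α * lam ≠ 0 := by
  have hα' : (α : ℂ) ≠ 0 := by exact_mod_cast hα.ne'
  contrapose! h
  field_simp
  linear_combination h

/-- The characteristic determinant of the generalised boundary-eigenvalue problem. -/
noncomputable def charDet (α β η δ k01 k02 k03 k04 k11 k12 k13 k14 : ℝ) (lam : ℂ) : ℂ :=
  (boundaryMatrix
    ![k01 + lam * k02, k03 + lam * k04, k11 + lam * k12, k13 + lam * k14]
    (companion (-(δ * lam + lam ^ 2) / (1 + α * lam))
      (-(2 * (lam * β * Real.sqrt η)) / (1 + α * lam)) (-η / (1 + α * lam)))).det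

lemma differentiableOn_charDet {α : ℝ} (hα : 0 < α)
    (β η δ k01 k02 k03 k04 k11 k12 k13 k14 : ℝ) :
    DifferentiableOn ℂ (charDet α β η δ k01 k02 k03 k04 k11 k12 k13 k14) {-(1 / (α : ℂ))}ᶜ := by
  have hne : ∀ z ∈ ({-(1 / (α : ℂ))}ᶜ : Set ℂ), 1 + α * z ≠ 0 := fun z hz =>
    one_add_mul_ne_zero hα hz
  refine differentiableOn_det_boundaryMatrix (differentiableOn_pi.2 fun i => ?_)
    (DifferentiableOn.companion ?_ ?_ ?_)
  · fin_cases i <;> simp <;> fun_prop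
  all_goals fun_prop (disch := assumption)

lemma IsEigenvalue.charDet_eq_zero {α β η δ k01 k02 k03 k04 k11 k12 k13 k14 : ℝ} (hα : 0 < α)
    {lam : ℂ} (h : IsEigenvalue α β η δ k01 k02 k03 k04 k11 k12 k13 k14 lam) :
    charDet α β η δ k01 k02 k03 k04 k11 k12 k13 k14 lam = 0 := by
  obtain ⟨hlam, w, hw, ⟨s, hs, hws⟩, hode, b0, b1, b2, b3⟩ := h
  have hm := one_add_mul_ne_zero hα hlam
  unfold charDet
  set A := companion (-(δ * lam + lam ^ 2) / (1 + α * lam))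
      (-(2 * (lam * β * Real.sqrt η)) / (1 + α * lam)) (-η / (1 + α * lam)) with hA
  let y : ℝ → Fin 4 → ℂ := fun t i => iteratedDeriv i w t
  have hd : ∀ i : Fin 4, ∀ t, HasDerivAt (iteratedDeriv i w) (iteratedDeriv (i + 1) w t) t := by
    intro i t
    rw [iteratedDeriv_succ]
    refine (hw.differentiable_iteratedDeriv i ?_ t).hasDerivAt
    exact_mod_cast i.2
  have hy : ∀ t ∈ Set.Icc (0 : ℝ) 1, HasDerivAt y (A (y t)) t := by
    intro t ht
    refine hasDerivAt_pi.2 fun i => ?_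
    have e : A (y t) i = iteratedDeriv (i + 1) w t := by
      have := hode t ht
      rw [hA, companion_apply]
      fin_cases i
      · simp [y]
      · simp [y]
      · simp [y]
      · simp [y]
        linear_combination (-(1 + α * lam)⁻¹) * this
          + iteratedDeriv 4 w t * mul_inv_cancel₀ hm
    rw [e]
    exact hd i t
  have hsol := eqOn_exp_smul_of_hasDerivAt A hy
  refine Matrix.exists_mulVec_eq_zero_iff.1 ⟨y 0, fun h0 => hws ?_, ?_⟩
  · have := congrFun (hsol hs) 0
    simpa [h0, y] using this
  · have h1 : NormedSpace.exp A (y 0) = y 1 := by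
      simpa using (hsol (Set.right_mem_Icc.2 zero_le_one)).symm
    rw [boundaryMatrix_mulVec, h1]
    ext i
    fin_cases i <;> simp [boundaryForm, y, b0, b1, b2, b3] <;> ring

/-- Some positive real number is not an eigenvalue. -/
lemma exists_charDet_ne_zero {α β η δ k01 k02 k03 k04 k11 k12 k13 k14 : ℝ}
    (hα : 0 < α) (hβ : 0 ≤ β) (hη : 0 ≤ η) (hδ : 0 ≤ δ)
    (h01 : 0 < k01) (h02 : 0 ≤ k02) (h03 : 0 < k03) (h04 : 0 < k04)
    (h11 : 0 ≤ k11) (h12 : 0 ≤ k12) (h13 : 0 ≤ k13) (h14 : 0 ≤ k14) :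
    ∃ lam : ℝ, 0 < lam ∧ charDet α β η δ k01 k02 k03 k04 k11 k12 k13 k14 lam ≠ 0 := by
  obtain ⟨l, hl1, hlη, hlα, hlk⟩ : ∃ l : ℝ, 1 ≤ l ∧ η ≤ l ∧ η / α ≤ l ∧
      β * Real.sqrt η / (α * k04) ≤ l :=
    ((Filter.eventually_ge_atTop 1).and ((Filter.eventually_ge_atTop η).and
      ((Filter.eventually_ge_atTop (η / α)).and (Filter.eventually_ge_atTop _)))).exists
  have hl : 0 < l := by linarith
  rw [div_le_iff₀ hα] at hlα
  rw [div_le_iff₀ (by positivity)] at hlk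
  refine ⟨l, hl, ?_⟩
  have h := det_boundaryMatrix_ne_zero (m := 1 + α * l) (η := η) (b := l * β * Real.sqrt η)
    (κ := δ * l + l ^ 2) (K0 := k01 + l * k02) (K1 := k03 + l * k04) (K2 := k11 + l * k12)
    (K3 := k13 + l * k14) hη (by nlinarith) (by positivity)
    (by nlinarith [mul_nonneg hδ hl.le]) (by positivity) (by positivity)
    (by
      have : l * (β * Real.sqrt η) ≤ l * (l * (α * k04)) := by gcongr
      have : 0 < k03 + l * k04 + α * l * k03 := by positivity
      nlinarith) (by positivity) (by positivity)
  simpa [charDet] using h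

/-- the set of eigenvalues of the generalised boundary-eigenvalue problem has
no accumulation point in `ℂ \ {−1/α}`; the only possible accumulation points in the
extended complex plane are `−1/α` and infinity. -/
theorem eigenvalues_no_accumulation (α β η δ k01 k02 k03 k04 k11 k12 k13 k14 : ℝ)
    (hα : 0 < α) (hβ0 : 0 < β) (hβ1 : β < 1) (hη : 0 ≤ η) (hδ : 0 ≤ δ)
    (h01 : 0 < k01) (h02 : 0 < k02) (h03 : 0 < k03) (h04 : 0 < k04)
    (h11 : 0 < k11) (h12 : 0 < k12) (h13 : 0 < k13) (h14 : 0 < k14) :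
    ∀ z : ℂ, z ≠ -(1 / α) →
      ¬ AccPt z (Filter.principal
        {lam : ℂ | IsEigenvalue α β η δ k01 k02 k03 k04 k11 k12 k13 k14 lam}) := by
  intro z hz hacc
  obtain ⟨l, hl, hne⟩ := exists_charDet_ne_zero hα hβ0.le hη hδ h01 h02.le h03 h04 h11.le h12.le
    h13.le h14.le
  have hfreq := (accPt_iff_frequently_nhdsNE.1 hacc).mono fun lam h =>
    IsEigenvalue.charDet_eq_zero hα h
  have hconn : IsPreconnected ({-(1 / (α : ℂ))}ᶜ : Set ℂ) :=
    (isConnected_compl_singleton_of_one_lt_rank (by simp [Complex.rank_real_complex]) _).isPreconnected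
  refine hne (((differentiableOn_charDet hα β η δ k01 k02 k03 k04 k11 k12 k13 k14).analyticOnNhd
    isOpen_compl_singleton).eqOn_zero_of_preconnected_of_frequently_eq_zero hconn hz hfreq ?_)
  have : (l : ℝ) ≠ -(1 / α) := by
    have : 0 < 1 / α := by positivity
    linarith
  rw [Set.mem_compl_singleton_iff]
  exact_mod_cast this
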